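/- arXiv:1703.06612 — 3 statements merged into one kernel-verified Lean document; each statement's English description precedes it below -/
import Mathlib

section
/- Let n ≥ 4 and let T be an admissible family of ordered pairs on Fin n such that both n−2 and n−1 (the last two elements of Fin n) occur as first coordinates of pairs of T. Let c : Fin n → Fin (n−1) be the collapsing map given by c(k) = k for k ≤ n−2 and c(n−1) = n−2. Then every pair in the image family T' := {(c(i), c(j)) : (i,j) ∈ T} has distinct coordinates, and T' is an admissible family of ordered pairs on Fin (n−1). -/
/-- The half-open arc `[i, j)` in the cyclically ordered set `Fin n`:
the set of `x` such that the clock distance from `i` to `x` is smaller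
than the clock distance from `i` to `j`. -/
def arcSet {n : ℕ} (i j : Fin n) : Set (Fin n) :=
  {x | ((x - i : Fin n) : ℕ) < ((j - i : Fin n) : ℕ)}

/-- A finite family of ordered pairs `(i, j)` (thought of as the arcs `[i, j)`)
is admissible if all pairs have distinct coordinates, any two arcs meeting
in at least one point are nested, and any two disjoint arcs have a union
which is not an arc. -/
def IsAdmissible {n : ℕ} (T : Finset (Fin n × Fin n)) : Prop :=
  (∀ p ∈ T, p.1 ≠ p.2) ∧
  ∀ p ∈ T, ∀ q ∈ T, p ≠ q →
    ((arcSet p.1 p.2 ∩ arcSet q.1 q.2).Nonempty →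
        arcSet p.1 p.2 ⊆ arcSet q.1 q.2 ∨ arcSet q.1 q.2 ⊆ arcSet p.1 p.2) ∧
    (arcSet p.1 p.2 ∩ arcSet q.1 q.2 = ∅ → p.2 ≠ q.1 ∧ q.2 ≠ p.1)

theorem mem_arcSet {n : ℕ} {i j x : Fin n} :
    x ∈ arcSet i j ↔
      (i.val ≤ x.val ∧ x.val < j.val) ∨ (j.val < i.val ∧ (i.val ≤ x.val ∨ x.val < j.val)) := by
  have val_sub (a b : Fin n) :
      ((a - b : Fin n) : ℕ) = if b.val ≤ a.val then a.val - b.val else n + a.val - b.val := by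
    have := a.isLt
    have := b.isLt
    split_ifs with h
    · exact Fin.coe_sub_iff_le.mpr h
    · exact Fin.coe_sub_iff_lt.mpr (not_le.mp h)
  have := i.isLt
  have := j.isLt
  have := x.isLt
  rw [arcSet, Set.mem_ofPred_eq, val_sub, val_sub]
  split_ifs <;> omega

/-- In an admissible family no vertex is both a target and a source. -/
theorem IsAdmissible.target_ne_source {n : ℕ} {T : Finset (Fin n × Fin n)} (hT : IsAdmissible T)
    {p q : Fin n × Fin n} (hp : p ∈ T) (hq : q ∈ T) : p.2 ≠ q.1 := by
  obtain ⟨i, a⟩ := p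
  obtain ⟨a', j⟩ := q
  rintro (rfl : a = a')
  have hia : i ≠ a := hT.1 _ hp
  have haj : a ≠ j := hT.1 _ hq
  obtain ⟨hmeet, hdisj⟩ := hT.2 _ hp _ hq fun h => hia (Prod.ext_iff.mp h).1
  rw [Ne, Fin.ext_iff] at hia haj
  have := i.isLt
  have := a.isLt
  have := j.isLt
  rcases Set.eq_empty_or_nonempty (arcSet i a ∩ arcSet a j) with h | h
  · exact (hdisj h).1 rfl
  · rcases hmeet h with hsub | hsub
    · obtain ⟨b, hb⟩ : ∃ b : Fin n, b.val = if a.val = 0 then n - 1 else a.val - 1 :=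
        ⟨⟨if a.val = 0 then n - 1 else a.val - 1, by split_ifs <;> omega⟩, rfl⟩
      have hbp : b ∈ arcSet i a := mem_arcSet.mpr (by split_ifs at hb <;> omega)
      have hbq := mem_arcSet.mp (hsub hbp)
      dsimp only at hbq
      split_ifs at hb <;> omega
    · have haq : a ∈ arcSet a j := mem_arcSet.mpr (by omega)
      have hap := mem_arcSet.mp (hsub haq)
      dsimp only at hap
      omega

/-- The map `Fin n → Fin (n - 1)` sending the last vertex to the one before it and
fixing all others. -/
def collapse {n : ℕ} (hn : 2 ≤ n) (k : Fin n) : Fin (n - 1) :=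
  ⟨min k.val (n - 2), by omega⟩

theorem val_collapse {n : ℕ} (hn : 2 ≤ n) (k : Fin n) :
    (collapse hn k).val = min k.val (n - 2) := rfl

theorem collapse_ne_of_lt {n : ℕ} (hn : 2 ≤ n) {j k : Fin n} (hj : j.val < n - 2) (hjk : j ≠ k) :
    collapse hn j ≠ collapse hn k := by
  rw [Ne, Fin.ext_iff] at hjk ⊢
  rw [val_collapse, val_collapse]
  omega

theorem last_mem_arcSet {n : ℕ} {i j x : Fin n} (hj : j.val < n - 2) (hx : x ∈ arcSet i j)
    (hx' : n - 2 ≤ x.val) : (⟨n - 1, by omega⟩ : Fin n) ∈ arcSet i j := by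
  rw [mem_arcSet] at hx ⊢
  dsimp only
  omega

theorem arcSet_collapse {n : ℕ} (hn : 2 ≤ n) {i j : Fin n} (hj : j.val < n - 2) :
    arcSet (collapse hn i) (collapse hn j) = collapse hn '' arcSet i j := by
  have := i.isLt
  ext x
  have := x.isLt
  simp only [Set.mem_image, mem_arcSet, Fin.ext_iff, val_collapse]
  constructor
  · intro hx
    by_cases hx' : x.val < n - 2
    · exact ⟨⟨x.val, by omega⟩, by dsimp only; omega, by dsimp only; omega⟩
    · exact ⟨⟨n - 1, by omega⟩, by dsimp only; omega, by dsimp only; omega⟩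
  · rintro ⟨y, hy, hyx⟩
    have := y.isLt
    omega

theorem arcSet_inter_nonempty_of_collapse {n : ℕ} (hn : 2 ≤ n) {i j k l : Fin n}
    (hj : j.val < n - 2) (hl : l.val < n - 2)
    (h : (collapse hn '' arcSet i j ∩ collapse hn '' arcSet k l).Nonempty) :
    (arcSet i j ∩ arcSet k l).Nonempty := by
  obtain ⟨_, ⟨x, hx, rfl⟩, y, hy, hxy⟩ := h
  rw [Fin.ext_iff, val_collapse, val_collapse] at hxy
  by_cases hlt : x.val < n - 2
  · obtain rfl : y = x := Fin.ext (by omega)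
    exact ⟨y, hx, hy⟩
  · exact ⟨_, last_mem_arcSet hj hx (by omega), last_mem_arcSet hl hy (by omega)⟩

/-- If no target lies in `{n - 2, n - 1}`, the collapse of an admissible family is admissible. -/
theorem IsAdmissible.image_collapse {n : ℕ} (hn : 2 ≤ n) {T : Finset (Fin n × Fin n)}
    (hT : IsAdmissible T) (htgt : ∀ p ∈ T, p.2.val < n - 2) :
    IsAdmissible (T.image fun p => (collapse hn p.1, collapse hn p.2)) := by
  simp only [IsAdmissible, Finset.forall_mem_image]
  refine ⟨fun p hp => (collapse_ne_of_lt hn (htgt p hp) (hT.1 p hp).symm).symm,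
    fun p hp q hq hpq => ?_⟩
  obtain ⟨hmeet, -⟩ := hT.2 p hp q hq fun h => hpq (by rw [h])
  rw [arcSet_collapse hn (htgt p hp), arcSet_collapse hn (htgt q hq)]
  refine ⟨fun h => ?_, fun _ => ⟨?_, ?_⟩⟩
  · exact (hmeet (arcSet_inter_nonempty_of_collapse hn (htgt p hp) (htgt q hq) h)).imp
      (fun h => Set.image_mono h) (fun h => Set.image_mono h)
  · exact collapse_ne_of_lt hn (htgt p hp) (hT.target_ne_source hp hq)
  · exact collapse_ne_of_lt hn (htgt q hq) (hT.target_ne_source hq hp)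

/-- Collapsing the vertex `n-1` onto the vertex `n-2` maps an admissible family
on `Fin n`, in which both `n-2` and `n-1` occur as sources, to an admissible
family on `Fin (n-1)` all of whose pairs have distinct coordinates. -/
theorem admissible_collapse (n : ℕ) (hn : 4 ≤ n)
    (T : Finset (Fin n × Fin n)) (hT : IsAdmissible T)
    (hsrc₁ : ∃ j, ((⟨n - 2, by omega⟩ : Fin n), j) ∈ T)
    (hsrc₂ : ∃ j, ((⟨n - 1, by omega⟩ : Fin n), j) ∈ T) :
    (∀ p ∈ T.image (fun p : Fin n × Fin n =>
        ((⟨min p.1.val (n - 2), by omega⟩ : Fin (n - 1)),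
         (⟨min p.2.val (n - 2), by omega⟩ : Fin (n - 1)))), p.1 ≠ p.2) ∧
    IsAdmissible (T.image (fun p : Fin n × Fin n =>
        ((⟨min p.1.val (n - 2), by omega⟩ : Fin (n - 1)),
         (⟨min p.2.val (n - 2), by omega⟩ : Fin (n - 1))))) := by
  obtain ⟨_, hr⟩ := hsrc₁
  obtain ⟨_, hs⟩ := hsrc₂
  have htgt : ∀ p ∈ T, p.2.val < n - 2 := by
    intro p hp
    have hpr := Fin.val_ne_of_ne (hT.target_ne_source hp hr)
    have hps := Fin.val_ne_of_ne (hT.target_ne_source hp hs)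
    dsimp only at hpr hps
    omega
  have hadm := hT.image_collapse (by omega) htgt
  exact ⟨hadm.1, hadm⟩
end

section
/- Let n ≥ 3 and let T be an admissible family of ordered pairs on Fin n with exactly n − 1 elements. Then the vectors {e_i − e_j : (i,j) ∈ T} form a ℤ-basis of the type A root lattice: for every x : Fin n → ℤ with ∑ᵢ x i = 0 there exist unique integers (c_p)_{p ∈ T} such that ∑_{(i,j) ∈ T} c_{(i,j)} • (e_i − e_j) equals x (viewed coordinatewise as a vector of ℝⁿ). -/
/-- The indicator of the arc `[i, j)` has discrete derivative `e_i - e_j`. -/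
theorem indicator_arcSet_sub {m : ℕ} {i j : Fin (m + 1)} (hij : i ≠ j) (k : Fin (m + 1)) :
    (arcSet i j).indicator (1 : Fin (m + 1) → ℤ) k - (arcSet i j).indicator 1 (k - 1) =
      (if k = i then 1 else 0) - (if k = j then 1 else 0) := by
  classical
  have hd : ((j - i : Fin (m + 1)) : ℕ) ≠ 0 := by
    rw [Ne, Fin.val_eq_zero_iff, sub_eq_zero]
    exact hij.symm
  have hki : k = i ↔ ((k - i : Fin (m + 1)) : ℕ) = 0 := by
    rw [Fin.val_eq_zero_iff, sub_eq_zero]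
  have hkj : k = j ↔ ((k - i : Fin (m + 1)) : ℕ) = ((j - i : Fin (m + 1)) : ℕ) := by
    rw [← Fin.ext_iff, sub_left_inj]
  have hlt := (j - i).isLt
  have hsub : k - 1 - i = k - i - 1 := by abel
  simp only [Set.indicator_apply, arcSet, Set.mem_ofPred_eq, Pi.one_apply, hki, hkj, hsub,
    Fin.coe_sub_one, ← Fin.val_eq_zero_iff]
  split_ifs <;> first | rfl | omega

section Arc

variable {m : ℕ} {i j k : Fin (m + 1)}

theorem mem_arcSet_of_sub_one_notMem_iff (hij : i ≠ j) :
    k ∈ arcSet i j ∧ k - 1 ∉ arcSet i j ↔ k = i := by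
  classical
  have h := indicator_arcSet_sub hij k
  simp only [Set.indicator_apply, Pi.one_apply] at h
  grind

theorem notMem_arcSet_of_sub_one_mem_iff (hij : i ≠ j) :
    k ∉ arcSet i j ∧ k - 1 ∈ arcSet i j ↔ k = j := by
  classical
  have h := indicator_arcSet_sub hij k
  simp only [Set.indicator_apply, Pi.one_apply] at h
  grind

theorem eq_of_arcSet_eq {p q : Fin (m + 1) × Fin (m + 1)} (hp : p.1 ≠ p.2) (hq : q.1 ≠ q.2)
    (h : arcSet p.1 p.2 = arcSet q.1 q.2) : p = q := by
  refine Prod.ext ?_ ?_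
  · rw [← mem_arcSet_of_sub_one_notMem_iff hq, ← h, mem_arcSet_of_sub_one_notMem_iff hp]
  · rw [← notMem_arcSet_of_sub_one_mem_iff hq, ← h, notMem_arcSet_of_sub_one_mem_iff hp]

end Arc

namespace IsAdmissible

variable {m : ℕ} {T : Finset (Fin (m + 1) × Fin (m + 1))} {p q : Fin (m + 1) × Fin (m + 1)}

theorem ssubset_of_snd_mem (hT : IsAdmissible T) (hp : p ∈ T) (hq : q ∈ T)
    (h : p.2 ∈ arcSet q.1 q.2) : arcSet p.1 p.2 ⊂ arcSet q.1 q.2 := by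
  obtain ⟨hp2, hp2'⟩ := (notMem_arcSet_of_sub_one_mem_iff (hT.1 p hp)).2 rfl
  have hpq : p ≠ q := by
    rintro rfl
    exact hp2 h
  obtain ⟨hmeet, hdisj⟩ := hT.2 p hp q hq hpq
  have hne : (arcSet p.1 p.2 ∩ arcSet q.1 q.2).Nonempty := by
    by_contra hempty
    rw [Set.not_nonempty_iff_eq_empty] at hempty
    refine (hdisj hempty).1 ((mem_arcSet_of_sub_one_notMem_iff (hT.1 q hq)).1 ⟨h, fun h' ↦ ?_⟩)
    exact hempty.subset ⟨hp2', h'⟩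
  rcases hmeet hne with hsub | hsub
  · exact ⟨hsub, fun h' ↦ hp2 (h' h)⟩
  · exact (hp2 (hsub h)).elim

theorem exists_forall_notMem (hT : IsAdmissible T) :
    ∃ u, ∀ p ∈ T, u ∉ arcSet p.1 p.2 := by
  rcases T.eq_empty_or_nonempty with rfl | hne
  · simp
  obtain ⟨p, hp, hmax⟩ := T.exists_max_image (fun p ↦ (arcSet p.1 p.2).ncard) hne
  exact ⟨p.2, fun q hq h ↦
    (hmax q hq).not_gt (Set.ncard_lt_ncard (hT.ssubset_of_snd_mem hp hq h))⟩

/-- Every arc of an admissible family has an element lying in no smaller arc of the family. -/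
theorem exists_mem_forall_notMem (hT : IsAdmissible T) (hp : p ∈ T) :
    ∃ v ∈ arcSet p.1 p.2, ∀ q ∈ T, arcSet q.1 q.2 ⊂ arcSet p.1 p.2 → v ∉ arcSet q.1 q.2 := by
  classical
  obtain ⟨hp1, hp1'⟩ := (mem_arcSet_of_sub_one_notMem_iff (hT.1 p hp)).2 rfl
  let S := T.filter fun q ↦ arcSet q.1 q.2 ⊂ arcSet p.1 p.2 ∧ p.1 ∈ arcSet q.1 q.2
  rcases S.eq_empty_or_nonempty with hS | hS
  · refine ⟨p.1, hp1, fun q hq hqp h ↦ ?_⟩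
    exact Finset.eq_empty_iff_forall_notMem.1 hS q (Finset.mem_filter.2 ⟨hq, hqp, h⟩)
  obtain ⟨q, hqS, hmax⟩ := S.exists_max_image (fun q ↦ (arcSet q.1 q.2).ncard) hS
  obtain ⟨hq, hqp, hpq⟩ := Finset.mem_filter.1 hqS
  refine ⟨q.2, ?_, fun r hr hrp h ↦ ?_⟩
  · by_contra h
    have hsnd : q.2 = p.2 := (notMem_arcSet_of_sub_one_mem_iff (hT.1 p hp)).1
      ⟨h, hqp.1 ((notMem_arcSet_of_sub_one_mem_iff (hT.1 q hq)).2 rfl).2⟩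
    have hfst : p.1 = q.1 := (mem_arcSet_of_sub_one_notMem_iff (hT.1 q hq)).1
      ⟨hpq, fun h' ↦ hp1' (hqp.1 h')⟩
    exact hqp.ne (by rw [hsnd, hfst])
  · have hqr := hT.ssubset_of_snd_mem hq hr h
    exact (hmax r (Finset.mem_filter.2 ⟨hr, hrp, hqr.1 hpq⟩)).not_gt (Set.ncard_lt_ncard hqr)

/-- If the arcs of an admissible family are sampled at points `v p` lying in the arc `p` but in no
smaller arc, the resulting incidence matrix is unitriangular. -/
theorem det_incidence_eq_one (hT : IsAdmissible T) {v : {p // p ∈ T} → Fin (m + 1)}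
    (hv : ∀ p q : {p // p ∈ T}, v p ∈ arcSet q.1.1 q.1.2 →
      arcSet p.1.1 p.1.2 ⊆ arcSet q.1.1 q.1.2)
    (hmem : ∀ p : {p // p ∈ T}, v p ∈ arcSet p.1.1 p.1.2) :
    (Matrix.of fun p q : {p // p ∈ T} ↦
      (arcSet q.1.1 q.1.2).indicator (1 : Fin (m + 1) → ℤ) (v p)).det = 1 := by
  classical
  let b : {p // p ∈ T} → ℕ := fun p ↦ (arcSet p.1.1 p.1.2).ncard
  rw [Matrix.BlockTriangular.det (b := b)]
  · refine Finset.prod_eq_one fun a _ ↦ ?_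
    refine Eq.trans (congrArg Matrix.det ?_) (Matrix.det_one (n := {p // b p = a}))
    ext ⟨p, hp⟩ ⟨q, hq⟩
    by_cases hpq : p = q
    · subst hpq
      simp [Matrix.toSquareBlock_def, hmem]
    · rw [Matrix.one_apply_ne (by simpa using hpq)]
      refine Set.indicator_of_notMem (fun h ↦ hpq ?_) _
      refine Subtype.ext (eq_of_arcSet_eq (hT.1 _ p.2) (hT.1 _ q.2) ?_)
      exact Set.eq_of_subset_of_ncard_le (hv p q h) (hq.trans hp.symm).le
  · intro p q hlt
    exact Set.indicator_of_notMem (fun h ↦ hlt.not_ge (Set.ncard_le_ncard (hv p q h))) _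

end IsAdmissible

theorem Fin.eq_of_forall_eq_sub_one {m : ℕ} {α : Type*} {h : Fin (m + 1) → α}
    (hh : ∀ k, h k = h (k - 1)) (k l : Fin (m + 1)) : h k = h l := by
  have h0 : ∀ k, h k = h 0 := by
    intro k
    induction k using Fin.induction with
    | zero => rfl
    | succ i ih => rw [hh, ← Fin.coeSucc_eq_succ, add_sub_cancel_right, ih]
  rw [h0 k, h0 l]

theorem Fin.exists_sub_eq_of_sum_eq_zero {m : ℕ} {x : Fin (m + 1) → ℤ} (hx : ∑ i, x i = 0) :
    ∃ f : Fin (m + 1) → ℤ, ∀ k, f k - f (k - 1) = x k := by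
  refine ⟨fun k ↦ ∑ i ∈ Finset.Iic k, x i, fun k ↦ ?_⟩
  induction k using Fin.cases with
  | zero =>
    have h1 : (0 : Fin (m + 1)) - 1 = Fin.last m := by
      rw [sub_eq_iff_eq_add, Fin.last_add_one]
    have h2 : Finset.Iic (Fin.last m) = Finset.univ := by
      ext i
      simp [Fin.le_last]
    have h3 : Finset.Iic (0 : Fin (m + 1)) = {0} := by
      ext i
      simp
    simp [h1, h2, h3, hx]
  | succ i =>
    have h1 : i.succ - 1 = i.castSucc := by
      rw [← Fin.coeSucc_eq_succ, add_sub_cancel_right]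
    have h2 : Finset.Iic i.succ = insert i.succ (Finset.Iic i.castSucc) := by
      ext j
      simp only [Finset.mem_Iic, Finset.mem_insert, Fin.le_def, Fin.ext_iff, Fin.val_succ,
        Fin.val_castSucc]
      omega
    simp only [h1, h2]
    rw [Finset.sum_insert (by simp [Fin.le_def])]
    ring

theorem sum_smul_single_sub_single_eq_iff {n : ℕ} {ι : Type*} [Fintype ι] (a b : ι → Fin n)
    (c : ι → ℤ) (x : Fin n → ℤ) :
    ∑ p, (c p : ℝ) • (EuclideanSpace.single (a p) (1 : ℝ) - EuclideanSpace.single (b p) (1 : ℝ))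
        = ∑ i, (x i : ℝ) • EuclideanSpace.single i (1 : ℝ) ↔
      ∀ k, ∑ p, c p * ((if k = a p then 1 else 0) - (if k = b p then 1 else 0)) = x k := by
  have key : ∀ k, (∑ p, (c p : ℝ) * ((if k = a p then 1 else 0) - (if k = b p then 1 else 0))
      = x k ↔ ∑ p, c p * ((if k = a p then 1 else 0) - (if k = b p then 1 else 0)) = x k) := by
    intro k
    rw [← Int.cast_inj (α := ℝ)]
    push_cast
    rfl
  simp only [← key, PiLp.ext_iff]
  simp [Pi.single_apply]

/-- For an admissible family `T` with exactly `n - 1` elements, the vectors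
`e_i - e_j`, `(i,j) ∈ T`, form a ℤ-basis of the type A root lattice: every
integer vector with coordinate sum `0` is in a unique way an integral
combination of them. -/
theorem admissible_is_lattice_basis (n : ℕ) (hn : 3 ≤ n)
    (T : Finset (Fin n × Fin n)) (hT : IsAdmissible T) (hcard : T.card = n - 1)
    (x : Fin n → ℤ) (hx : ∑ i, x i = 0) :
    ∃! c : {p // p ∈ T} → ℤ,
      ∑ p : {p // p ∈ T},
          (c p : ℝ) • (EuclideanSpace.single p.1.1 (1 : ℝ) - EuclideanSpace.single p.1.2 (1 : ℝ))
        = ∑ i, (x i : ℝ) • EuclideanSpace.single i (1 : ℝ) := by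
  obtain ⟨m, rfl⟩ : ∃ m, n = m + 1 := ⟨n - 1, by omega⟩
  obtain ⟨u, hu⟩ := hT.exists_forall_notMem
  choose v hmem hmin using fun p : {p // p ∈ T} ↦ hT.exists_mem_forall_notMem p.2
  have hv : ∀ p q : {p // p ∈ T}, v p ∈ arcSet q.1.1 q.1.2 →
      arcSet p.1.1 p.1.2 ⊆ arcSet q.1.1 q.1.2 := by
    intro p q h
    by_cases hpq : p = q
    · rw [hpq]
    rcases (hT.2 p p.2 q q.2 (Subtype.coe_injective.ne hpq)).1 ⟨v p, hmem p, h⟩ with hsub | hsub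
    · exact hsub
    · by_contra hnot
      exact hmin p q q.2 ⟨hsub, hnot⟩ h
  have hinj : Function.Injective v := by
    intro p q h
    refine Subtype.ext (eq_of_arcSet_eq (hT.1 _ p.2) (hT.1 _ q.2) ?_)
    exact (hv p q (h ▸ hmem q)).antisymm (hv q p (h ▸ hmem p))
  have hsurj : ∀ k, k ≠ u → ∃ p, v p = k := by
    have himage : Finset.univ.image v = Finset.univ.erase u := by
      refine Finset.eq_of_subset_of_card_le (fun k hk ↦ ?_) ?_
      · obtain ⟨p, -, rfl⟩ := Finset.mem_image.1 hk
        refine Finset.mem_erase.2 ⟨fun h ↦ hu p p.2 (h ▸ hmem p), Finset.mem_univ _⟩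
      · rw [Finset.card_image_of_injective _ hinj, Finset.card_erase_of_mem (Finset.mem_univ _)]
        simp [hcard]
    intro k hk
    simpa using himage.ge (Finset.mem_erase.2 ⟨hk, Finset.mem_univ _⟩)
  obtain ⟨f, hf⟩ := Fin.exists_sub_eq_of_sum_eq_zero hx
  let M : Matrix {p // p ∈ T} {p // p ∈ T} ℤ :=
    Matrix.of fun p q ↦ (arcSet q.1.1 q.1.2).indicator 1 (v p)
  have hM : IsUnit M.det := by
    rw [hT.det_incidence_eq_one hv hmem]
    exact isUnit_one
  have hiff : ∀ c : {p // p ∈ T} → ℤ,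
      ∑ p : {p // p ∈ T},
          (c p : ℝ) • (EuclideanSpace.single p.1.1 (1 : ℝ) - EuclideanSpace.single p.1.2 (1 : ℝ))
        = ∑ i, (x i : ℝ) • EuclideanSpace.single i (1 : ℝ) ↔
      M.mulVec c = fun p ↦ f (v p) - f u := by
    intro c
    let g : Fin (m + 1) → ℤ := fun k ↦ ∑ p : {p // p ∈ T},
      c p * (arcSet p.1.1 p.1.2).indicator (1 : Fin (m + 1) → ℤ) k
    have hgu : g u = 0 := Finset.sum_eq_zero fun p _ ↦ by
      rw [Set.indicator_of_notMem (hu p p.2), mul_zero]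
    have hMg : ∀ p, M.mulVec c p = g (v p) := fun p ↦
      Finset.sum_congr rfl fun q _ ↦ mul_comm _ _
    have hg : ∀ k, ∑ p : {p // p ∈ T},
        c p * ((if k = p.1.1 then 1 else 0) - (if k = p.1.2 then 1 else 0)) =
          g k - g (k - 1) := by
      intro k
      rw [← Finset.sum_sub_distrib]
      refine Finset.sum_congr rfl fun p _ ↦ ?_
      rw [← indicator_arcSet_sub (hT.1 p p.2), mul_sub]
    rw [sum_smul_single_sub_single_eq_iff (fun p : {p // p ∈ T} ↦ p.1.1) (fun p ↦ p.1.2)]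
    simp only [hg, funext_iff, hMg]
    constructor
    · intro h p
      have := Fin.eq_of_forall_eq_sub_one (h := fun k ↦ g k - f k)
        (fun k ↦ by linarith [h k, hf k]) (v p) u
      linarith
    · intro h
      have hgf : ∀ k, g k = f k - f u := by
        intro k
        by_cases hk : k = u
        · rw [hk, hgu, sub_self]
        · obtain ⟨p, rfl⟩ := hsurj k hk
          exact h p
      intro k
      rw [hgf, hgf, ← hf k]
      ring
  simp only [hiff]
  refine ⟨M⁻¹.mulVec fun p ↦ f (v p) - f u, ?_, fun c hc ↦ ?_⟩
  · simp only [Matrix.mulVec_mulVec, Matrix.mul_nonsing_inv M hM, Matrix.one_mulVec]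
  · rw [← hc, Matrix.mulVec_mulVec, Matrix.nonsing_inv_mul M hM, Matrix.one_mulVec]
end

section
/- Let X be a finite type with at least two elements and let ρ : X → X → ℝ be a nonnegative function such that ρ x y = 0 if and only if x = y. Let KR(ρ) := convexHull ℝ {(ρ x y)⁻¹ • (e_x − e_y) : x, y ∈ X, x ≠ y} ⊆ EuclideanSpace ℝ X. Then ρ satisfies the triangle inequality (ρ x z ≤ ρ x y + ρ y z for all x, y, z) if and only if for every pair x ≠ y the point (ρ x y)⁻¹ • (e_x − e_y) does not belong to the intrinsic interior (the interior relative to the affine span, Mathlib's intrinsicInterior) of KR(ρ). -/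
section IntrinsicInterior

variable {E : Type*} [NormedAddCommGroup E] [NormedSpace ℝ E] {s : Set E} {x y p : E}

theorem mem_intrinsicInterior_iff_exists_ball :
    p ∈ intrinsicInterior ℝ s ↔
      p ∈ affineSpan ℝ s ∧ ∃ ε > 0, ∀ z ∈ affineSpan ℝ s, dist z p < ε → z ∈ s := by
  simp only [mem_intrinsicInterior, mem_interior_iff_mem_nhds, Metric.mem_nhds_iff]
  constructor
  · rintro ⟨q, ⟨ε, hε, h⟩, rfl⟩
    exact ⟨q.2, ε, hε, fun z hz hzq ↦ h (show (⟨z, hz⟩ : affineSpan ℝ s) ∈ _ from hzq)⟩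
  · rintro ⟨hp, ε, hε, h⟩
    exact ⟨⟨p, hp⟩, ⟨ε, hε, fun z hz ↦ h z z.2 hz⟩, rfl⟩

/-- A point on the half-open segment from a relative interior point `x` of a convex set to a point
`y` of that set is a relative interior point. -/
theorem Convex.combo_mem_intrinsicInterior (hs : Convex ℝ s) (hx : x ∈ intrinsicInterior ℝ s)
    (hy : y ∈ s) {a b : ℝ} (ha : 0 < a) (hb : 0 ≤ b) (hab : a + b = 1) :
    a • x + b • y ∈ intrinsicInterior ℝ s := by
  have hxs := intrinsicInterior_subset hx
  obtain ⟨hx', ε, hε, h⟩ := mem_intrinsicInterior_iff_exists_ball.1 hx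
  have hp : a • x + b • y ∈ affineSpan ℝ s :=
    subset_affineSpan ℝ s (hs hxs hy ha.le hb hab)
  refine mem_intrinsicInterior_iff_exists_ball.2 ⟨hp, a * ε, by positivity, fun z hz hzp ↦ ?_⟩
  have hw : a⁻¹ • (z - (a • x + b • y)) + x ∈ s := by
    refine h _ ((affineSpan ℝ s).smul_vsub_vadd_mem a⁻¹ hz hp hx') ?_
    rw [dist_eq_norm] at hzp ⊢
    rw [add_sub_cancel_right, norm_smul, Real.norm_of_nonneg (by positivity)]
    rwa [inv_mul_lt_iff₀ ha]
  have hz' : a • (a⁻¹ • (z - (a • x + b • y)) + x) + b • y = z := by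
    rw [smul_add, smul_inv_smul₀ ha.ne']
    abel
  exact hz' ▸ hs hw hy ha.le hb hab

/-- A point at which a linear functional that is not constant on `s` attains its maximum over `s`
is not in the relative interior of `s`. -/
theorem notMem_intrinsicInterior_of_forall_le (f : E →ₗ[ℝ] ℝ) (hle : ∀ z ∈ s, f z ≤ f p)
    (hy : y ∈ s) (hlt : f y < f p) : p ∉ intrinsicInterior ℝ s := by
  intro hp
  obtain ⟨hp', ε, hε, h⟩ := mem_intrinsicInterior_iff_exists_ball.1 hp
  have hn : 0 < ‖p - y‖ := norm_pos_iff.2 (sub_ne_zero.2 fun h ↦ hlt.ne (by rw [h]))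
  have hδ : 0 < ε / (2 * ‖p - y‖) := by positivity
  have hz : (ε / (2 * ‖p - y‖)) • (p - y) + p ∈ s := by
    refine h _ ((affineSpan ℝ s).smul_vsub_vadd_mem _ hp' (subset_affineSpan ℝ s hy) hp') ?_
    rw [dist_eq_norm, add_sub_cancel_right, norm_smul, Real.norm_of_nonneg hδ.le]
    field_simp
    linarith
  have := hle _ hz
  rw [map_add, map_smul, map_sub, smul_eq_mul] at this
  nlinarith [mul_pos hδ (sub_pos.2 hlt)]

/-- If a negative multiple of every point of a nonempty convex set is again in the set, then `0` is
in its relative interior. -/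
theorem Convex.zero_mem_intrinsicInterior [FiniteDimensional ℝ E] (hs : Convex ℝ s)
    (hne : s.Nonempty) {c : ℝ} (hc : 0 < c) (h : ∀ z ∈ s, -(c • z) ∈ s) :
    (0 : E) ∈ intrinsicInterior ℝ s := by
  obtain ⟨z, hz⟩ := hne.intrinsicInterior hs
  have := hs.combo_mem_intrinsicInterior hz (h z (intrinsicInterior_subset hz))
    (a := c / (1 + c)) (b := 1 / (1 + c)) (by positivity) (by positivity) (by field_simp; ring)
  convert this using 1
  rw [smul_neg, smul_smul, ← sub_eq_add_neg, ← sub_smul]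
  ring_nf
  simp

end IntrinsicInterior

/-- The vertex `(ρ x y)⁻¹ • (e_x - e_y)` of the Kantorovich–Rubinstein polytope. -/
noncomputable def krVertex {X : Type*} [DecidableEq X] (ρ : X → X → ℝ)
    (x y : X) : EuclideanSpace ℝ X :=
  (ρ x y)⁻¹ • (EuclideanSpace.single x (1 : ℝ) - EuclideanSpace.single y (1 : ℝ))

/-- The Kantorovich–Rubinstein polytope. -/
def krPolytope {X : Type*} [DecidableEq X] (ρ : X → X → ℝ) : Set (EuclideanSpace ℝ X) :=
  convexHull ℝ {v | ∃ x y, x ≠ y ∧ v = krVertex ρ x y}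

section KantorovichRubinstein

variable {X : Type*} [DecidableEq X] {ρ : X → X → ℝ} {x y z : X}

theorem convex_krPolytope : Convex ℝ (krPolytope ρ) := convex_convexHull ℝ _

theorem krVertex_mem_krPolytope (hxy : x ≠ y) : krVertex ρ x y ∈ krPolytope ρ :=
  subset_convexHull ℝ _ ⟨x, y, hxy, rfl⟩

theorem smul_krVertex (h : ρ x y ≠ 0) :
    ρ x y • krVertex ρ x y =
      EuclideanSpace.single x (1 : ℝ) - EuclideanSpace.single y (1 : ℝ) :=
  smul_inv_smul₀ h _

theorem combo_krVertex_mem_krPolytope (hpos : ∀ x y, x ≠ y → 0 < ρ x y)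
    (hxy : x ≠ y) (hyz : y ≠ z) :
    (ρ x y + ρ y z)⁻¹ • (EuclideanSpace.single x (1 : ℝ) - EuclideanSpace.single z (1 : ℝ)) ∈
      krPolytope ρ := by
  have h₁ := hpos x y hxy
  have h₂ := hpos y z hyz
  have := convex_krPolytope (krVertex_mem_krPolytope (ρ := ρ) hxy)
    (krVertex_mem_krPolytope (ρ := ρ) hyz)
    (a := (ρ x y + ρ y z)⁻¹ * ρ x y) (b := (ρ x y + ρ y z)⁻¹ * ρ y z)
    (by positivity) (by positivity) (by field_simp)
  rwa [mul_smul, mul_smul, smul_krVertex h₁.ne', smul_krVertex h₂.ne', ← smul_add,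
    sub_add_sub_cancel] at this

theorem zero_mem_krPolytope [Nontrivial X] (hpos : ∀ x y, x ≠ y → 0 < ρ x y) :
    (0 : EuclideanSpace ℝ X) ∈ krPolytope ρ := by
  obtain ⟨x, y, hxy⟩ := exists_pair_ne X
  simpa using combo_krVertex_mem_krPolytope hpos hxy hxy.symm

theorem exists_neg_smul_mem_krPolytope [Finite X] [Nontrivial X]
    (hpos : ∀ x y, x ≠ y → 0 < ρ x y) :
    ∃ c : ℝ, 0 < c ∧ ∀ v ∈ krPolytope ρ, -(c • v) ∈ krPolytope ρ := by
  obtain ⟨M, hM⟩ := Finite.exists_le fun i : X × X ↦ ρ i.2 i.1 / ρ i.1 i.2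
  have hM' : 0 < max M 1 := by positivity
  refine ⟨(max M 1)⁻¹, by positivity, fun v hv ↦ ?_⟩
  suffices krPolytope ρ ⊆ (-((max M 1)⁻¹ • LinearMap.id : EuclideanSpace ℝ X →ₗ[ℝ] _)) ⁻¹'
      krPolytope ρ from this hv
  refine convexHull_min ?_ (convex_krPolytope.linear_preimage _)
  rintro _ ⟨x, y, hxy, rfl⟩
  change -((max M 1)⁻¹ • krVertex ρ x y) ∈ krPolytope ρ
  have h₁ := hpos x y hxy
  have h₂ := hpos y x hxy.symm
  have hr : ρ y x / ρ x y ≤ max M 1 := (hM (x, y)).trans (le_max_left _ _)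
  have := convex_krPolytope.smul_mem_of_zero_mem (zero_mem_krPolytope hpos)
    (krVertex_mem_krPolytope (ρ := ρ) hxy.symm) (t := (max M 1)⁻¹ * (ρ y x / ρ x y))
    ⟨by positivity, by rwa [inv_mul_le_iff₀ hM', mul_one]⟩
  convert this using 1
  rw [mul_smul, ← smul_neg, div_eq_inv_mul, mul_smul, smul_krVertex h₂.ne', krVertex, ← smul_neg,
    neg_sub]

theorem krVertex_mem_intrinsicInterior [Fintype X] (hpos : ∀ x y, x ≠ y → 0 < ρ x y)
    (hxy : x ≠ y) (hyz : y ≠ z) (hxz : x ≠ z)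
    (hlt : ρ x y + ρ y z < ρ x z) :
    krVertex ρ x z ∈ intrinsicInterior ℝ (krPolytope ρ) := by
  have : Nontrivial X := ⟨x, y, hxy⟩
  obtain ⟨c, hc, h⟩ := exists_neg_smul_mem_krPolytope hpos
  have h0 := convex_krPolytope.zero_mem_intrinsicInterior ⟨0, zero_mem_krPolytope hpos⟩ hc h
  have h₁ := hpos x y hxy
  have h₂ := hpos y z hyz
  have h₃ := hpos x z hxz
  have := convex_krPolytope.combo_mem_intrinsicInterior h0
    (combo_krVertex_mem_krPolytope hpos hxy hyz)
    (a := 1 - (ρ x y + ρ y z) / ρ x z) (b := (ρ x y + ρ y z) / ρ x z)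
    (by rw [sub_pos, div_lt_one h₃]; exact hlt) (by positivity) (by ring)
  rw [smul_zero, zero_add, smul_smul] at this
  rwa [div_mul_eq_mul_div, mul_inv_cancel₀ (by positivity), one_div] at this

theorem krVertex_notMem_intrinsicInterior [Fintype X] (hpos : ∀ x y, x ≠ y → 0 < ρ x y)
    (hself : ∀ x, ρ x x = 0) (htri : ∀ x y z, ρ x z ≤ ρ x y + ρ y z) (hxy : x ≠ y) :
    krVertex ρ x y ∉ intrinsicInterior ℝ (krPolytope ρ) := by
  let f : EuclideanSpace ℝ X →ₗ[ℝ] ℝ := (innerSL ℝ (WithLp.toLp 2 fun a ↦ ρ a y)).toLinearMap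
  have hf (a b : X) : f (krVertex ρ a b) = (ρ a b)⁻¹ * (ρ a y - ρ b y) := by
    simp [f, krVertex, inner_sub_right, EuclideanSpace.inner_single_right]
  have h₁ := hpos x y hxy
  have h₂ := hpos y x hxy.symm
  have hfx : f (krVertex ρ x y) = 1 := by
    rw [hf, hself, sub_zero, inv_mul_cancel₀ h₁.ne']
  refine notMem_intrinsicInterior_of_forall_le f (y := krVertex ρ y x) ?_
    (krVertex_mem_krPolytope hxy.symm) ?_
  · rw [hfx]
    suffices krPolytope ρ ⊆ {v | f v ≤ 1} from this
    refine convexHull_min ?_ (convex_halfSpace_le f.isLinear 1)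
    rintro _ ⟨a, b, hab, rfl⟩
    change f (krVertex ρ a b) ≤ 1
    rw [hf, inv_mul_le_iff₀ (hpos a b hab)]
    linarith [htri a b y]
  · rw [hfx, hf, hself, zero_sub]
    have : 0 < (ρ y x)⁻¹ * ρ x y := by positivity
    linarith

end KantorovichRubinstein


/-- A nonnegative function `ρ`, vanishing exactly on the diagonal, satisfies the
triangle inequality if and only if none of the points `(ρ x y)⁻¹ • (e_x - e_y)`
lies in the intrinsic (relative) interior of the Kantorovich–Rubinstein polytope
`KR(ρ) = conv{(ρ x y)⁻¹ • (e_x - e_y) : x ≠ y}`. -/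
theorem triangle_iff_not_mem_intrinsicInterior_KR
    (X : Type*) [Fintype X] [DecidableEq X] (hX : 1 < Fintype.card X)
    (ρ : X → X → ℝ) (hnn : ∀ x y, 0 ≤ ρ x y) (h0 : ∀ x y, ρ x y = 0 ↔ x = y) :
    (∀ x y z, ρ x z ≤ ρ x y + ρ y z) ↔
      ∀ x y, x ≠ y →
        (ρ x y)⁻¹ • (EuclideanSpace.single x (1 : ℝ) - EuclideanSpace.single y (1 : ℝ)) ∉
          intrinsicInterior ℝ (convexHull ℝ {v : EuclideanSpace ℝ X |
            ∃ x y, x ≠ y ∧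
              v = (ρ x y)⁻¹ •
                (EuclideanSpace.single x (1 : ℝ) - EuclideanSpace.single y (1 : ℝ))}) := by
  have hpos (x y : X) (h : x ≠ y) : 0 < ρ x y :=
    (hnn x y).lt_of_ne fun h' ↦ h ((h0 x y).1 h'.symm)
  have hself (x : X) : ρ x x = 0 := (h0 x x).2 rfl
  refine ⟨fun htri x y hxy ↦ krVertex_notMem_intrinsicInterior hpos hself htri hxy,
    fun h x y z ↦ ?_⟩
  by_contra! hlt
  have hxy : x ≠ y := by
    rintro rfl
    simp [hself] at hlt
  have hyz : y ≠ z := by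
    rintro rfl
    simp [hself] at hlt
  have hxz : x ≠ z := by
    rintro rfl
    linarith [hself x, hnn x y, hnn y x]
  exact h x z hxz (krVertex_mem_intrinsicInterior hpos hxy hyz hxz hlt)
end
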